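/- arXiv:1907.02769 — 3 statements merged into one kernel-verified Lean document; each statement's English description precedes it below -/
import Mathlib

section
/- For every total analytic set A ⊆ ℕ^ℕ × ℕ^ℕ all of whose sections are closed, there exists a total analytic set H ⊆ ℕ^ℕ × ℕ^ℕ all of whose sections are homogeneous such that H is not ≤₂-reducible to A. -/
open MeasureTheory Set

/-- Baire space. -/
abbrev Baire : Type := ℕ → ℕ

/-- The `x`-th section of `A ⊆ Baire × Baire`. -/
def secAt (A : Set (Baire × Baire)) (x : Baire) : Set Baire := {y | (x, y) ∈ A}

/-- `A` is total if every section is nonempty. -/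
def IsTotalSet (A : Set (Baire × Baire)) : Prop := ∀ x, (secAt A x).Nonempty

/-- `g` is a choice function for `A`: `g x ∈ A(x)` whenever `A(x) ≠ ∅`. -/
def IsChoiceFor (g : Baire → Baire) (A : Set (Baire × Baire)) : Prop :=
  ∀ x, (secAt A x).Nonempty → g x ∈ secAt A x

/-- A subset of Baire space is homogeneous if it is a product `∏ₙ Bₙ`. -/
def IsHomogeneousSet (S : Set Baire) : Prop :=
  ∃ B : ℕ → Set ℕ, S = {y : Baire | ∀ n, y n ∈ B n}

/-- `A ≤₁ B`. -/
def Red1 (A B : Set (Baire × Baire)) : Prop :=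
  ∃ (h : Baire → Baire) (k : Baire → Baire), Continuous h ∧ Continuous k ∧
    ∀ g : Baire → Baire, IsChoiceFor g B → IsChoiceFor (fun x => k (g (h x))) A

/-- `A ≤₂ B`. -/
def Red2 (A B : Set (Baire × Baire)) : Prop :=
  ∃ (h : Baire → Baire) (k : Baire × Baire → Baire), Continuous h ∧ Continuous k ∧
    ∀ g : Baire → Baire, IsChoiceFor g B → IsChoiceFor (fun x => k (x, g (h x))) A

/-- `c` codes a sequence of `ℕ`-valued multifunctions on `W` (total, but possibly multivalued),
relative to a sequence `U` of basic open sets; `codeRel U c n w m` says that `m` is a value of the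
`n`-th one at `w`. -/
def codeRel {W : Type*} (U : ℕ → Set W) (c : Baire) (n : ℕ) (w : W) (m : ℕ) : Prop :=
  (∃ i, w ∈ U i ∧ c (Nat.pair n i) = m + 1) ∨ ∀ i, w ∈ U i → c (Nat.pair n i) = 0

lemma exists_codeRel {W : Type*} (U : ℕ → Set W) (c : Baire) (n : ℕ) (w : W) :
    ∃ m, codeRel U c n w m := by
  by_cases h : ∀ i, w ∈ U i → c (Nat.pair n i) = 0
  · exact ⟨0, Or.inr h⟩
  · push Not at h
    obtain ⟨i, hi, hc⟩ := h
    exact ⟨c (Nat.pair n i) - 1, Or.inl ⟨i, hi, by omega⟩⟩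

/-- Every sequence of continuous `ℕ`-valued functions has a code. -/
lemma exists_code_of_continuous {W : Type*} [TopologicalSpace W] {U : ℕ → Set W}
    (hU : TopologicalSpace.IsTopologicalBasis (range U)) (F : ℕ → W → ℕ)
    (hF : ∀ n, Continuous (F n)) :
    ∃ c : Baire, ∀ n w m, codeRel U c n w m → m = F n w := by
  classical
  let v : ℕ → ℕ → ℕ := fun n i =>
    if h : ∃ m, ∀ w ∈ U i, F n w = m then h.choose + 1 else 0
  have hv : ∀ n i w, w ∈ U i → v n i ≠ 0 → v n i = F n w + 1 := by
    intro n i w hw hne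
    by_cases h : ∃ m, ∀ w ∈ U i, F n w = m
    · simp only [v, dif_pos h, h.choose_spec w hw]
    · simp [v, h] at hne
  refine ⟨fun j => v j.unpair.1 j.unpair.2, fun n w m hm => ?_⟩
  simp only [codeRel, Nat.unpair_pair] at hm
  rcases hm with ⟨i, hi, hc⟩ | hm
  · have := hv n i w hi (by omega)
    omega
  · exfalso
    obtain ⟨_, ⟨i, rfl⟩, hi, hsub⟩ := hU.exists_subset_of_mem_open (a := w)
      (u := F n ⁻¹' {F n w}) rfl ((isOpen_discrete _).preimage (hF n))
    have hex : ∃ m, ∀ w ∈ U i, F n w = m := ⟨F n w, fun w' hw' => hsub hw'⟩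
    have := hm i hi
    simp [v, hex] at this

lemma measurableSet_codeRel {W X : Type*} [MeasurableSpace W] [MeasurableSpace X]
    {U : ℕ → Set W} (hU : ∀ i, MeasurableSet (U i)) (n : ℕ) {c : X → Baire} {w : X → W}
    {m : X → ℕ} (hc : Measurable c) (hw : Measurable w) (hm : Measurable m) :
    MeasurableSet {x | codeRel U (c x) n (w x) (m x)} := by
  have hcj : ∀ j, Measurable fun x => c x j := fun j => (measurable_pi_apply j).comp hc
  have h1 : MeasurableSet (⋃ i, {x | w x ∈ U i} ∩ {x | c x (Nat.pair n i) = m x + 1}) :=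
    .iUnion fun i => (hw (hU i)).inter
      (measurableSet_eq_fun (hcj _) (hm.add measurable_const))
  have h2 : MeasurableSet (⋂ i, {x | w x ∈ U i}ᶜ ∪ {x | c x (Nat.pair n i) = 0}) :=
    .iInter fun i => (hw (hU i)).compl.union (measurableSet_eq_fun (hcj _) measurable_const)
  convert h1.union h2 using 1
  ext x
  simp [codeRel, imp_iff_not_or]

lemma analyticSet_inter {X : Type*} [TopologicalSpace X] [T2Space X] {s t : Set X}
    (hs : AnalyticSet s) (ht : AnalyticSet t) : AnalyticSet (s ∩ t) := by
  rw [inter_eq_iInter]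
  exact AnalyticSet.iInter fun b => by cases b <;> assumption

/-- The set whose section at `x` consists of the `z` with `z 0` greater than some value at `x`
of the reduction to `A` coded by `x`. -/
def diagSet (U : ℕ → Set (Baire × Baire)) (A : Set (Baire × Baire)) : Set (Baire × Baire) :=
  {p | ∃ u y : Baire, ∃ m : ℕ, (∀ n, codeRel U p.1 (n + 1) (p.1, p.1) (u n)) ∧
    (u, y) ∈ A ∧ codeRel U p.1 0 (p.1, y) m ∧ m < p.2 0}

lemma analyticSet_diagSet {U : ℕ → Set (Baire × Baire)} (hU : ∀ i, IsOpen (U i))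
    {A : Set (Baire × Baire)} (hA : AnalyticSet A) : AnalyticSet (diagSet U A) := by
  have : PolishSpace ((Baire × Baire) × (Baire × Baire) × ℕ) := { }
  have : BorelSpace ((Baire × Baire) × ℕ) := Prod.borelSpace
  have : BorelSpace ((Baire × Baire) × (Baire × Baire) × ℕ) := Prod.borelSpace
  have hUm := fun i => (hU i).measurableSet
  let M : Set ((Baire × Baire) × (Baire × Baire) × ℕ) := (⋂ n, {t | codeRel U t.1.1 (n + 1) (t.1.1, t.1.1) (t.2.1.1 n)}) ∩
    ({t | codeRel U t.1.1 0 (t.1.1, t.2.1.2) t.2.2} ∩ {t | t.2.2 < t.1.2 0})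
  have hM : MeasurableSet M := by
    refine (MeasurableSet.iInter fun n => ?_).inter (.inter ?_ ?_)
    · exact measurableSet_codeRel hUm _ (by fun_prop) (by fun_prop) (by fun_prop)
    · exact measurableSet_codeRel hUm _ (by fun_prop) (by fun_prop) (by fun_prop)
    · exact measurableSet_lt (by fun_prop) (by fun_prop)
  have hA' : AnalyticSet ((fun t : (Baire × Baire) × (Baire × Baire) × ℕ => t.2.1) ⁻¹' A) := hA.preimage (by fun_prop)
  have himage := (analyticSet_inter hM.analyticSet hA').image_of_continuous
    (f := Prod.fst) (by fun_prop)
  convert himage using 1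
  ext p
  constructor
  · rintro ⟨u, y, m, hu, hy, hm, hlt⟩
    exact ⟨(p, (u, y), m), ⟨⟨mem_iInter.2 hu, hm, hlt⟩, hy⟩, rfl⟩
  · rintro ⟨⟨p', ⟨u, y⟩, m⟩, ⟨⟨hu, hm, hlt⟩, hy⟩, rfl⟩
    exact ⟨u, y, m, mem_iInter.1 hu, hy, hm, hlt⟩

lemma isTotalSet_diagSet (U : ℕ → Set (Baire × Baire)) {A : Set (Baire × Baire)}
    (hA : IsTotalSet A) : IsTotalSet (diagSet U A) := by
  intro x
  choose u hu using fun n => exists_codeRel U x (n + 1) (x, x)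
  obtain ⟨y, hy⟩ := hA u
  obtain ⟨m, hm⟩ := exists_codeRel U x 0 (x, y)
  exact ⟨fun _ => m + 1, u, y, m, hu, hy, hm, m.lt_succ_self⟩

lemma isHomogeneousSet_diagSet (U : ℕ → Set (Baire × Baire)) (A : Set (Baire × Baire))
    (x : Baire) : IsHomogeneousSet (secAt (diagSet U A) x) := by
  refine ⟨fun n => {j | n = 0 → (fun _ => j) ∈ secAt (diagSet U A) x}, ?_⟩
  ext z
  simp [secAt, diagSet]

lemma not_red2_diagSet {U : ℕ → Set (Baire × Baire)}
    (hU : TopologicalSpace.IsTopologicalBasis (range U)) {A : Set (Baire × Baire)}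
    (hA : IsTotalSet A) : ¬ Red2 (diagSet U A) A := by
  classical
  rintro ⟨h, k, hh, hk, hred⟩
  let F : ℕ → Baire × Baire → ℕ := fun n w => Nat.casesOn n (k w 0) fun i => h w.1 i
  have hF : ∀ n, Continuous (F n) := by
    rintro (_ | n)
    · exact (continuous_apply 0).comp hk
    · exact (continuous_apply n).comp (hh.comp continuous_fst)
  obtain ⟨x, hx⟩ := exists_code_of_continuous hU F hF
  have hmin : ∃ j, ∃ y ∈ secAt A (h x), k (x, y) 0 = j :=
    let ⟨y, hy⟩ := hA (h x); ⟨_, y, hy, rfl⟩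
  obtain ⟨y, hy, hyj⟩ := Nat.find_spec hmin
  choose g hg using hA
  have hchoice : IsChoiceFor (Function.update g (h x) y) A := by
    intro a _
    by_cases ha : a = h x
    · subst ha
      simpa using hy
    · simpa [ha] using hg a
  have hmem := hred _ hchoice x (isTotalSet_diagSet U (fun a => ⟨g a, hg a⟩) x)
  simp only [Function.update_self] at hmem
  obtain ⟨u, y', m, hu, hy', hm, hlt⟩ := hmem
  obtain rfl : u = h x := funext fun n => hx _ _ _ (hu n)
  obtain rfl : m = k (x, y') 0 := hx _ _ _ hm
  exact Nat.find_min hmin (hyj ▸ hlt) ⟨y', hy', rfl⟩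

/-- For every total analytic set `A` with closed sections, there is a total
analytic set `H` with homogeneous sections which is not `≤₂`-reducible to `A`. -/
theorem exists_homogeneous_not_red2_closed :
    ∀ A : Set (Baire × Baire), AnalyticSet A → IsTotalSet A →
      (∀ x, IsClosed (secAt A x)) →
      ∃ H : Set (Baire × Baire), AnalyticSet H ∧ IsTotalSet H ∧
        (∀ x, IsHomogeneousSet (secAt H x)) ∧ ¬ Red2 H A := by
  intro A hA htot _
  obtain ⟨V, hV, -⟩ := (TopologicalSpace.isBasis_countableBasis
    (Baire × Baire)).exists_subset_of_mem_open (mem_univ default) isOpen_univ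
  obtain ⟨U, hU⟩ :=
    (TopologicalSpace.countable_countableBasis (Baire × Baire)).exists_eq_range ⟨V, hV⟩
  have hbasis : TopologicalSpace.IsTopologicalBasis (range U) :=
    hU ▸ TopologicalSpace.isBasis_countableBasis (Baire × Baire)
  exact ⟨diagSet U A, analyticSet_diagSet (fun i => hbasis.isOpen ⟨i, rfl⟩) hA,
    isTotalSet_diagSet U htot, isHomogeneousSet_diagSet U A, not_red2_diagSet hbasis htot⟩
end

section
/- There exists a total F_σδ set S ⊆ ℕ^ℕ × ℕ^ℕ all of whose sections are G_δ such that S is not ≡₂-equivalent to any analytic set A ⊆ ℕ^ℕ × ℕ^ℕ all of whose sections are closed. -/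
open MeasureTheory Set

/-- A set is `F_σδ` if it is a countable intersection of countable unions of
closed sets. -/
def IsFSigmaDelta {X : Type*} [TopologicalSpace X] (S : Set X) : Prop :=
  ∃ F : ℕ → ℕ → Set X, (∀ i j, IsClosed (F i j)) ∧ S = ⋂ i, ⋃ j, F i j

/-- The index coding the restriction of `x` to its first `m` entries together with `n`. -/
def prefixCode (x : Baire) (m n : ℕ) : ℕ :=
  Encodable.encode ((⟨m, fun i => x i⟩ : Σ m, Fin m → ℕ), n)

/-- Reading `x` as a code of a partial continuous function, the value of this function at `x`
has `n`-th entry `y n`, and the `m`-th prefix of `x` is the first one that determines it. -/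
def DiagHit (n m : ℕ) (p : Baire × Baire) : Prop :=
  p.1 (prefixCode p.1 m n) = p.2 n + 1 ∧ ∀ m' < m, p.1 (prefixCode p.1 m' n) = 0

/-- The graph of the partial map sending `x` to the value at `x` of the partial continuous
function coded by `x`. -/
def diagGraph : Set (Baire × Baire) := {p | ∀ n, ∃ m, DiagHit n m p}

theorem continuous_apply_prefixCode (m n : ℕ) :
    Continuous fun x : Baire => x (prefixCode x m n) := by
  have hcode : Continuous fun x : Baire => prefixCode x m n :=
    (continuous_of_discreteTopology (f := fun s : Fin m → ℕ =>
      Encodable.encode ((⟨m, s⟩ : Σ m, Fin m → ℕ), n))).comp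
      (continuous_pi fun i : Fin m => continuous_apply (i : ℕ))
  have heval : Continuous fun p : Baire × ℕ => p.1 p.2 :=
    continuous_prod_of_discrete_right.2 fun i => continuous_apply i
  exact heval.comp (continuous_id.prodMk hcode)

theorem isOpen_setOf_diagHit (n m : ℕ) : IsOpen {p | DiagHit n m p} := by
  have hc (m' : ℕ) : Continuous fun p : Baire × Baire => p.1 (prefixCode p.1 m' n) :=
    (continuous_apply_prefixCode m' n).comp continuous_fst
  have hy : Continuous fun p : Baire × Baire => p.2 n + 1 :=
    (continuous_of_discreteTopology (f := fun v : ℕ => v + 1)).comp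
      ((continuous_apply n).comp continuous_snd)
  have hbound : IsOpen {p : Baire × Baire | ∀ m' < m, p.1 (prefixCode p.1 m' n) = 0} := by
    have : {p : Baire × Baire | ∀ m' < m, p.1 (prefixCode p.1 m' n) = 0} =
        ⋂ m' ∈ Set.Iio m, (fun p : Baire × Baire => p.1 (prefixCode p.1 m' n)) ⁻¹' {0} := by
      ext p
      simp
    rw [this]
    exact (Set.finite_Iio m).isOpen_biInter fun m' _ => (isOpen_discrete _).preimage (hc m')
  have heq : IsOpen {p : Baire × Baire | p.1 (prefixCode p.1 m n) = p.2 n + 1} :=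
    (isOpen_discrete {q : ℕ × ℕ | q.1 = q.2}).preimage ((hc m).prodMk hy)
  exact heq.inter hbound

theorem isFSigmaDelta_compl_diagGraph : IsFSigmaDelta diagGraphᶜ := by
  refine ⟨fun _ n => ⋂ m, {p | DiagHit n m p}ᶜ,
    fun _ n => isClosed_iInter fun m => (isOpen_setOf_diagHit n m).isClosed_compl, ?_⟩
  ext p
  simp [diagGraph]

theorem diagGraph_unique {x y z : Baire} (hy : (x, y) ∈ diagGraph) (hz : (x, z) ∈ diagGraph) :
    y = z := by
  funext n
  obtain ⟨m, hm, hm'⟩ := hy n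
  obtain ⟨l, hl, hl'⟩ := hz n
  dsimp only at hm hm' hl hl'
  rcases lt_trichotomy m l with h | rfl | h
  · have := hl' m h
    omega
  · omega
  · have := hm' l h
    omega

theorem isOpen_secAt_compl_diagGraph (x : Baire) : IsOpen (secAt diagGraphᶜ x) := by
  have hs : (secAt diagGraph x).Subsingleton := fun _ hy _ hz => diagGraph_unique hy hz
  exact hs.isClosed.isOpen_compl

theorem dense_secAt_compl_diagGraph (x : Baire) : Dense (secAt diagGraphᶜ x) := by
  intro y
  by_cases hy : (x, y) ∈ diagGraph
  · have hlim : Filter.Tendsto (fun j => Function.update y j (y j + 1)) Filter.atTop (nhds y) := by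
      refine tendsto_pi_nhds.2 fun i => tendsto_const_nhds.congr' ?_
      filter_upwards [Filter.eventually_gt_atTop i] with j hj
      rw [Function.update_of_ne hj.ne]
    refine mem_closure_of_tendsto hlim (Filter.Eventually.of_forall fun j hj => ?_)
    have := congrFun (diagGraph_unique hy hj) j
    simp at this
  · exact subset_closure hy

theorem exists_prefix_determines {f : Baire → Baire} (hf : Continuous f) (x : Baire) (n : ℕ) :
    ∃ m, ∀ z : Baire, (∀ i : Fin m, z i = x i) → f z n = f x n := by
  have ho : IsOpen {z | f z n = f x n} :=
    (isOpen_discrete {f x n}).preimage ((continuous_apply n).comp hf)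
  obtain ⟨_, ⟨w, m, rfl⟩, hx, hsub⟩ :=
    (PiNat.isTopologicalBasis_cylinders (fun _ : ℕ => ℕ)).exists_subset_of_mem_open
      (show x ∈ {z | f z n = f x n} from rfl) ho
  refine ⟨m, fun z hz => hsub fun i hi => ?_⟩
  rw [hz ⟨i, hi⟩, hx i hi]

open Classical in
theorem exists_mem_diagGraph {f : Baire → Baire} (hf : Continuous f) :
    ∃ x, (x, f x) ∈ diagGraph := by
  let c : (Σ m, Fin m → ℕ) × ℕ → ℕ := fun p =>
    if h : ∃ v, ∀ z : Baire, (∀ i : Fin p.1.1, z i = p.1.2 i) → f z p.2 = v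
    then h.choose + 1 else 0
  let x : Baire := fun i => (Encodable.decode i).elim 0 c
  have hxc (m n : ℕ) : x (prefixCode x m n) = c (⟨m, fun i => x i⟩, n) := by
    change (Encodable.decode (Encodable.encode _)).elim 0 c = _
    rw [Encodable.encodek]
    rfl
  refine ⟨x, fun n => ?_⟩
  have hex : ∃ m, x (prefixCode x m n) ≠ 0 := by
    obtain ⟨m, hm⟩ := exists_prefix_determines hf x n
    refine ⟨m, ?_⟩
    have h : ∃ v, ∀ z : Baire, (∀ i : Fin m, z i = x i) → f z n = v := ⟨_, hm⟩
    rw [hxc]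
    simp only [c]
    rw [dif_pos h]
    exact Nat.succ_ne_zero _
  refine ⟨Nat.find hex, ?_, fun m' hm' => not_not.1 (Nat.find_min hex hm')⟩
  have hne := Nat.find_spec hex
  change x (prefixCode x (Nat.find hex) n) = f x n + 1
  rw [hxc] at hne ⊢
  simp only [c] at hne ⊢
  split_ifs at hne ⊢ with h
  · rw [← h.choose_spec x fun _ => rfl]
  · exact absurd rfl hne

/-- A reduction `A ≤₂ B` maps nonempty sections of `B` into sections of `A`, and maps everything
into the sections of `A` whenever the corresponding section of `B` is empty. -/
theorem mem_secAt_of_reduction {A B : Set (Baire × Baire)} {h : Baire → Baire}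
    {k : Baire × Baire → Baire}
    (hk : ∀ g : Baire → Baire, IsChoiceFor g B → IsChoiceFor (fun x => k (x, g (h x))) A)
    {x y : Baire} (hA : (secAt A x).Nonempty) (hy : (secAt B (h x)).Nonempty → (h x, y) ∈ B) :
    k (x, y) ∈ secAt A x := by
  classical
  let g : Baire → Baire := fun z =>
    if z = h x then y else if hz : (secAt B z).Nonempty then hz.choose else y
  have hg : IsChoiceFor g B := by
    intro z hz
    by_cases hzx : z = h x
    · subst hzx
      simpa [g, secAt] using hy hz
    · simpa [g, hzx, hz] using hz.choose_spec
  simpa [g] using hk g hg x hA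

/-- If a total set with dense sections is `≡₂`-equivalent to a set with closed sections, then it
has a continuous choice function. -/
theorem exists_continuous_choice_of_equiv2 {S A : Set (Baire × Baire)} (hS : IsTotalSet S)
    (hd : ∀ x, Dense (secAt S x)) (hA : ∀ x, IsClosed (secAt A x))
    (hSA : Red2 S A) (hAS : Red2 A S) : ∃ f : Baire → Baire, Continuous f ∧ ∀ x, (x, f x) ∈ S := by
  obtain ⟨h, k, hh, hk, hred⟩ := hSA
  obtain ⟨h', k', -, hk', hred'⟩ := hAS
  refine ⟨fun x => k (x, k' (h x, 0)), ?_, fun x => ?_⟩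
  · exact hk.comp (continuous_id.prodMk (hk'.comp (hh.prodMk continuous_const)))
  · refine mem_secAt_of_reduction hred (hS x) fun hne => ?_
    have hcl : IsClosed ((fun y => k' (h x, y)) ⁻¹' secAt A (h x)) :=
      (hA (h x)).preimage (hk'.comp (continuous_const.prodMk continuous_id))
    have hsub : secAt S (h' (h x)) ⊆ (fun y => k' (h x, y)) ⁻¹' secAt A (h x) :=
      fun y hy => mem_secAt_of_reduction hred' hne fun _ => hy
    exact closure_minimal hsub hcl (hd _ 0)

/-- There is a total `F_σδ` set with `G_δ` sections which is not
`≡₂`-equivalent to any analytic set with closed sections. -/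
theorem exists_FSigmaDelta_not_equiv2_closed_sections :
    ∃ S : Set (Baire × Baire), IsTotalSet S ∧ IsFSigmaDelta S ∧
      (∀ x, IsGδ (secAt S x)) ∧
      ∀ A : Set (Baire × Baire), AnalyticSet A → (∀ x, IsClosed (secAt A x)) →
        ¬ (Red2 S A ∧ Red2 A S) := by
  have htotal : IsTotalSet diagGraphᶜ := fun x => (dense_secAt_compl_diagGraph x).nonempty
  refine ⟨diagGraphᶜ, htotal, isFSigmaDelta_compl_diagGraph,
    fun x => (isOpen_secAt_compl_diagGraph x).isGδ, fun A _ hA ⟨hSA, hAS⟩ => ?_⟩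
  obtain ⟨f, hf, hmem⟩ :=
    exists_continuous_choice_of_equiv2 htotal dense_secAt_compl_diagGraph hA hSA hAS
  obtain ⟨x, hx⟩ := exists_mem_diagGraph hf
  exact hmem x hx
end

section
/- There exists a uniformly Σ¹₁ family (Mₙ) of nonempty finite subsets of ℕ such that every nonempty compact Σ¹₁ subset of ℕ^ℕ is Medvedev reducible to ∏ₙMₙ. In particular, the Medvedev degrees of nonempty homogeneous Σ¹₁ sets with all factors finite, and of nonempty compact Σ¹₁ sets, each have a maximum element. -/
open Set

/-- The length-`n` initial segment of `x : Baire`, as a finite sequence. -/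
def pre (x : Baire) (n : ℕ) : List ℕ := (List.range n).map x

/-- A Turing functional, presented by a total computable monotone map on
finite sequences. -/
structure TuringFunctional where
  φ : List ℕ → List ℕ
  computable : Computable φ
  mono : ∀ σ τ : List ℕ, σ <+: τ → φ σ <+: φ τ

/-- `Φ` is defined on `x` with value `y`: every coordinate of `y` is eventually
output by `Φ` on initial segments of `x`. -/
def TuringFunctional.Eval (Φ : TuringFunctional) (x y : Baire) : Prop :=
  ∀ n, ∃ m, (Φ.φ (pre x m))[n]? = some (y n)

/-- Medvedev reducibility: some Turing functional is defined on every element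
of `Q` and maps `Q` into `P`. -/
def MedvedevLE (P Q : Set Baire) : Prop :=
  ∃ Φ : TuringFunctional, ∀ x ∈ Q, ∃ y ∈ P, Φ.Eval x y

/-- Strict Medvedev reducibility. -/
def MedvedevLT (P Q : Set Baire) : Prop := MedvedevLE P Q ∧ ¬ MedvedevLE Q P

/-- The homogeneous set `∏ₙ Aₙ`. -/
def homProd (A : ℕ → Set ℕ) : Set Baire := {x | ∀ n, x n ∈ A n}

/-- A family `(Aₙ)` of subsets of `ℕ` is uniformly `Σ¹₁`. -/
def UniformlySigma11 (A : ℕ → Set ℕ) : Prop :=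
  ∃ R : ℕ × ℕ → List ℕ → Bool, Computable₂ R ∧
    ∀ n m : ℕ, m ∈ A n ↔ ∃ y : Baire, ∀ k, R (n, m) (pre y k) = true

/-- A subset of Baire space is (lightface) `Σ¹₁`. -/
def Sigma11Set (S : Set Baire) : Prop :=
  ∃ R : List ℕ → List ℕ → Bool, Computable₂ R ∧
    ∀ x, x ∈ S ↔ ∃ y : Baire, ∀ m, R (pre x m) (pre y m) = true

/-- A set of finite sequences is (lightface) `Σ¹₁`. -/
def Sigma11List (T : Set (List ℕ)) : Prop :=
  ∃ R : List ℕ → List ℕ → Bool, Computable₂ R ∧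
    ∀ σ, σ ∈ T ↔ ∃ y : Baire, ∀ m, R σ (pre y m) = true

/-- A tree on `ℕ`: a set of finite sequences closed under prefixes. -/
def IsTree (T : Set (List ℕ)) : Prop := ∀ σ ∈ T, ∀ τ : List ℕ, τ <+: σ → τ ∈ T

/-- The set `[T]` of infinite paths through `T`. -/
def paths (T : Set (List ℕ)) : Set Baire := {x | ∀ n, pre x n ∈ T}

/-- A subset of `ℕ × ℕ` is (lightface) `Σ¹₁`. -/
def Sigma11Pairs (A : Set (ℕ × ℕ)) : Prop :=
  ∃ R : ℕ × ℕ → List ℕ → Bool, Computable₂ R ∧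
    ∀ p : ℕ × ℕ, p ∈ A ↔ ∃ y : Baire, ∀ k, R p (pre y k) = true

/-- A function `f : ℕ → ℕ` is `Δ¹₁`: its graph is both `Σ¹₁` and `Π¹₁`. -/
def Delta11Fun (f : ℕ → ℕ) : Prop :=
  Sigma11Pairs {p : ℕ × ℕ | f p.1 = p.2} ∧ Sigma11Pairs {p : ℕ × ℕ | f p.1 ≠ p.2}

open Encodable Denumerable
open Nat.Partrec (Code)
open Nat.Partrec.Code (evaln eval)

lemma pre_length (x : Baire) (n : ℕ) : (pre x n).length = n := by simp [pre]

lemma pre_succ (x : Baire) (n : ℕ) : pre x (n + 1) = pre x n ++ [x n] := by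
  simp [pre, List.range_succ]

lemma pre_getElem? (x : Baire) {n i : ℕ} (h : i < n) : (pre x n)[i]? = some (x i) := by
  simp [pre, h]

lemma pre_getElem?_of_le (x : Baire) {n i : ℕ} (h : n ≤ i) : (pre x n)[i]? = none := by
  simp [pre, h]

lemma pre_getD (x : Baire) {n i : ℕ} (h : i < n) : (pre x n).getD i 0 = x i := by
  simp [List.getD, pre_getElem? x h]

lemma pre_getD_of_le (x : Baire) {n i : ℕ} (h : n ≤ i) : (pre x n).getD i 0 = 0 := by
  simp [List.getD, pre_getElem?_of_le x h]

lemma pre_take (x : Baire) {m n : ℕ} (h : m ≤ n) : (pre x n).take m = pre x m := by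
  simp [pre, ← List.map_take, List.take_range, h]

lemma pre_map (f : ℕ → ℕ) (x : Baire) (n : ℕ) : (pre x n).map f = pre (fun i => f (x i)) n := by
  simp [pre]

lemma pre_eq_pre_iff {x y : Baire} {n : ℕ} : pre x n = pre y n ↔ ∀ i < n, x i = y i := by
  simp [pre]

lemma prefix_pre_iff {σ : List ℕ} {x : Baire} {n : ℕ} (h : σ.length ≤ n) :
    σ <+: pre x n ↔ pre x σ.length = σ := by
  rw [List.prefix_iff_eq_take, pre_take x h, eq_comm]

/-- `Evades A B σ τ` says that, in the game where one player extends `σ` inside `A` and the other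
answers by extending `τ` inside `B`, the first player can force the second to get stuck. -/
inductive Evades (A B : List ℕ → Bool) : List ℕ → List ℕ → Prop
  | intro (σ τ : List ℕ) (i : ℕ) (hi : A (σ ++ [i]) = true)
      (h : ∀ j, B (τ ++ [j]) = true → Evades A B (σ ++ [i]) (τ ++ [j])) : Evades A B σ τ

lemma Evades.not_swap {A B : List ℕ → Bool} {σ τ : List ℕ} (h : Evades A B σ τ) :
    ¬ Evades B A τ σ := by
  induction h with
  | intro σ τ i hi _ ih =>
    rintro ⟨_, _, j, hj, h'⟩
    exact ih j hj (h' i hi)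

/-- A path through `A` can be copied to a path through `B` by a player who does not get stuck. -/
lemma exists_path_of_not_evades {A B : List ℕ → Bool} (h : ¬ Evades A B [] [])
    (hB : B [] = true) {x : Baire} (hx : ∀ n, A (pre x n) = true) :
    ∃ y : Baire, ∀ n, B (pre y n) = true := by
  have step : ∀ n τ, ∃ j, ¬ Evades A B (pre x n) τ →
      ¬ Evades A B (pre x (n + 1)) (τ ++ [j]) ∧ B (τ ++ [j]) = true := by
    intro n τ
    by_contra! hc
    obtain ⟨hn, -⟩ := hc 0
    refine hn ⟨_, _, x n, pre_succ x n ▸ hx (n + 1), fun j hj => ?_⟩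
    by_contra hj'
    exact (hc j).2 (pre_succ x n ▸ hj') hj
  choose J hJ using step
  let t : ℕ → List ℕ := fun n => Nat.rec [] (fun n τ => τ ++ [J n τ]) n
  have ht : ∀ n, pre (fun n => J n (t n)) n = t n := by
    intro n
    induction n with
    | zero => rfl
    | succ n ih => rw [pre_succ, ih]
  have hne : ∀ n, ¬ Evades A B (pre x n) (t n) := by
    intro n
    induction n with
    | zero => exact h
    | succ n ih => exact (hJ n _ ih).1
  refine ⟨fun n => J n (t n), fun n => ?_⟩
  rw [ht]
  cases n with
  | zero => exact hB
  | succ n => exact (hJ n _ (hne n)).2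

/-- The local condition for a sequence to code a strategy for the second player of the game
described by `Evades`. At the position `(σ, τ)` with the move `i`, the value `0` means that the
position is not covered by the strategy, and `j + 1` means that the answer is `j`. -/
def strategyCheck (A B : List ℕ → Bool) (l : List ℕ) : Bool :=
  let p := ofNat (List ℕ × List ℕ × ℕ × ℕ) l.length.unpair.1
  let v := l.getD (encode (p.1, p.2.1, p.2.2.1)) 0
  !decide (l[encode (([] : List ℕ), ([] : List ℕ), p.2.2.1)]? = some 0) &&
    (decide (v = 0) || (!A (p.1 ++ [p.2.2.1]) || (B (p.2.1 ++ [v - 1]) &&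
      !decide (l[encode (p.1 ++ [p.2.2.1], p.2.1 ++ [v - 1], p.2.2.2)]? = some 0))))

lemma not_evades_iff_exists_strategy (A B : List ℕ → Bool) :
    ¬ Evades A B [] [] ↔ ∃ y : Baire, ∀ k, strategyCheck A B (pre y k) = true := by
  classical
  constructor
  · intro h
    have step : ∀ q : List ℕ × List ℕ × ℕ, ∃ j, ¬ Evades A B q.1 q.2.1 →
        A (q.1 ++ [q.2.2]) = true →
        B (q.2.1 ++ [j]) = true ∧ ¬ Evades A B (q.1 ++ [q.2.2]) (q.2.1 ++ [j]) := by
      rintro ⟨σ, τ, i⟩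
      by_contra! hc
      obtain ⟨hn, hi, -⟩ := hc 0
      exact hn ⟨_, _, i, hi, fun j hj => (hc j).2.2 hj⟩
    choose J hJ using step
    let y : Baire := fun n =>
      let q := ofNat (List ℕ × List ℕ × ℕ) n
      if Evades A B q.1 q.2.1 then 0 else J q + 1
    have hy : ∀ q : List ℕ × List ℕ × ℕ,
        y (encode q) = if Evades A B q.1 q.2.1 then 0 else J q + 1 := by
      intro q
      simp only [y, ofNat_encode]
    have hne : ∀ (q : List ℕ × List ℕ × ℕ) (k : ℕ), ¬ Evades A B q.1 q.2.1 →
        (pre y k)[encode q]? ≠ some 0 := by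
      intro q k hq
      rcases lt_or_ge (encode q) k with hk | hk
      · rw [pre_getElem? y hk, hy, if_neg hq]
        simp
      · simp [pre_getElem?_of_le y hk]
    refine ⟨y, fun k => ?_⟩
    simp only [strategyCheck, pre_length, Bool.and_eq_true, Bool.or_eq_true, Bool.not_eq_true',
      decide_eq_true_eq, decide_eq_false_iff_not]
    generalize ofNat (List ℕ × List ℕ × ℕ × ℕ) k.unpair.1 = p
    obtain ⟨σ, τ, i, i'⟩ := p
    refine ⟨hne ([], [], i) k h, or_iff_not_imp_left.2 fun hv => ?_⟩
    rcases lt_or_ge (encode (σ, τ, i)) k with hk | hk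
    · rw [pre_getD y hk, hy] at hv
      simp only [pre_getD y hk, hy]
      have hE : ¬ Evades A B σ τ := fun hE => hv (if_pos hE)
      simp only [hE, if_false, Nat.add_sub_cancel]
      cases hA : A (σ ++ [i]) with
      | false => exact Or.inl rfl
      | true =>
        obtain ⟨hB, hE'⟩ := hJ (σ, τ, i) hE hA
        exact Or.inr ⟨hB, hne (σ ++ [i], τ ++ [J (σ, τ, i)], i') k hE'⟩
    · exact absurd (pre_getD_of_le y hk) hv
  · rintro ⟨y, hy⟩ h
    have hlarge : ∀ (p : List ℕ × List ℕ × ℕ × ℕ) (b : ℕ), ∃ k, b < k ∧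
        ofNat (List ℕ × List ℕ × ℕ × ℕ) k.unpair.1 = p := by
      intro p b
      refine ⟨Nat.pair (encode p) (b + 1), ?_, by rw [Nat.unpair_pair, ofNat_encode]⟩
      exact lt_of_lt_of_le b.lt_succ_self (Nat.right_le_pair _ _)
    have hroot : ∀ i : ℕ, y (encode (([] : List ℕ), ([] : List ℕ), i)) ≠ 0 := by
      intro i
      obtain ⟨k, hk, hp⟩ := hlarge ([], [], i, 0) (encode (([] : List ℕ), ([] : List ℕ), i))
      have := hy k
      simp only [strategyCheck, pre_length, hp, pre_getElem? y hk, Bool.and_eq_true,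
        Bool.not_eq_true', decide_eq_false_iff_not, Option.some.injEq] at this
      exact this.1
    have key : ∀ σ τ, Evades A B σ τ → ∃ i : ℕ, y (encode (σ, τ, i)) = 0 := by
      intro σ τ hE
      induction hE with
      | intro σ τ i hi _ ih =>
        by_contra! hc
        set j := y (encode (σ, τ, i)) - 1 with hj
        have hall : ∀ i' : ℕ, B (τ ++ [j]) = true ∧
            y (encode (σ ++ [i], τ ++ [j], i')) ≠ 0 := by
          intro i'
          obtain ⟨k, hk, hp⟩ := hlarge (σ, τ, i, i')
            (max (encode (σ, τ, i)) (encode (σ ++ [i], τ ++ [j], i')))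
          have hk1 := lt_of_le_of_lt (le_max_left _ _) hk
          have hk2 := lt_of_le_of_lt (le_max_right _ _) hk
          have := hy k
          simp only [strategyCheck, pre_length, hp, pre_getD y hk1, ← hj, pre_getElem? y hk2,
            hi, hc i, Bool.and_eq_true, Bool.or_eq_true, Bool.not_eq_true', decide_eq_true_eq,
            decide_eq_false_iff_not, Option.some.injEq, false_or, Bool.true_eq_false] at this
          exact this.2
        obtain ⟨i', hi'⟩ := ih j (hall 0).1
        exact (hall i').2 hi'
    obtain ⟨i, hi⟩ := key _ _ h
    exact hroot i hi

/-- The nodes of a uniformly primitive recursive family of trees that represents every `Σ¹₁`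
predicate: the paths of the tree with index `⟨e, c⟩` are the `y` such that the program `e` never
outputs `0` on `⟨c, y↾k⟩`. -/
def node (i : ℕ) (l : List ℕ) : Bool :=
  !decide (evaln l.length.unpair.1 (ofNat Code i.unpair.1)
    (Nat.pair i.unpair.2 (encode (l.take l.length.unpair.2))) = some 0)

lemma node_nil (i : ℕ) : node i [] = true := by
  simp [node, evaln]

lemma primrec_node : Primrec₂ node := by
  have hl : Primrec fun p : ℕ × List ℕ => p.2.length.unpair :=
    Primrec.unpair.comp (Primrec.list_length.comp .snd)
  have hi : Primrec fun p : ℕ × List ℕ => p.1.unpair := Primrec.unpair.comp .fst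
  refine Primrec.not.comp (Primrec.eq.decide.comp (Nat.Partrec.Code.primrec_evaln.comp
    (((Primrec.fst.comp hl).pair ((Primrec.ofNat Code).comp (Primrec.fst.comp hi))).pair
      (Primrec₂.natPair.comp (Primrec.snd.comp hi) (Primrec.encode.comp
        (Primrec.list_take.comp (Primrec.snd.comp hl) .snd))))) (Primrec.const _))

/-- The tree with the given index has a path. -/
def HasPath (i : ℕ) : Prop := ∃ y : Baire, ∀ n, node i (pre y n) = true

lemma exists_index {α : Type*} [Primcodable α] {R : α → List ℕ → Bool} (hR : Computable₂ R) :
    ∃ e : ℕ, ∀ c, HasPath (Nat.pair e (encode c)) ↔ ∃ y : Baire, ∀ k, R c (pre y k) = true := by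
  obtain ⟨e, he⟩ := Nat.Partrec.Code.exists_code.1 hR
  refine ⟨encode e, fun c => exists_congr fun y => ?_⟩
  have hev : ∀ l : List ℕ,
      eval e (Nat.pair (encode c) (encode l)) = Part.some (encode (R c l)) := by
    intro l
    rw [he, ← encode_prod_val]
    simp only [encodek]
    simp
  simp only [node, pre_length, Nat.unpair_pair, ofNat_encode, Bool.not_eq_true',
    decide_eq_false_iff_not]
  constructor
  · intro h k
    by_contra hk
    have h0 : 0 ∈ eval e (Nat.pair (encode c) (encode (pre y k))) := by
      rw [hev, Bool.eq_false_of_not_eq_true hk]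
      exact Part.mem_some _
    obtain ⟨s, hs⟩ := Nat.Partrec.Code.evaln_complete.1 h0
    have := h (Nat.pair s k)
    rw [pre_take y (by simpa using Nat.right_le_pair s k)] at this
    simp only [Nat.unpair_pair] at this
    exact this hs
  · intro h n hn
    have := Nat.Partrec.Code.evaln_sound (Option.mem_def.2 hn)
    rw [pre_take y n.unpair_right_le, hev, h] at this
    simp at this

lemma primrec_strategyCheck : Primrec₂ fun (p : ℕ × ℕ) (l : List ℕ) =>
    strategyCheck (node p.1) (node p.2) l := by
  have hl : Primrec fun z : (ℕ × ℕ) × List ℕ => z.2 := .snd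
  have hp : Primrec fun z : (ℕ × ℕ) × List ℕ =>
      ofNat (List ℕ × List ℕ × ℕ × ℕ) z.2.length.unpair.1 :=
    (Primrec.ofNat _).comp (Primrec.fst.comp (Primrec.unpair.comp (Primrec.list_length.comp hl)))
  have hσ := Primrec.fst.comp hp
  have hτ := Primrec.fst.comp (Primrec.snd.comp hp)
  have hi := Primrec.fst.comp (Primrec.snd.comp (Primrec.snd.comp hp))
  have hi' := Primrec.snd.comp (Primrec.snd.comp (Primrec.snd.comp hp))
  have hv := (Primrec.list_getD 0).comp hl (Primrec.encode.comp (hσ.pair (hτ.pair hi)))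
  have hσ' := Primrec.list_concat.comp hσ hi
  have hτ' := Primrec.list_concat.comp hτ (Primrec.pred.comp hv)
  have hne {f : (ℕ × ℕ) × List ℕ → ℕ} (hf : Primrec f) :
      Primrec fun z => !decide (z.2[f z]? = some 0) :=
    Primrec.not.comp (Primrec.eq.decide.comp (Primrec.list_getElem?.comp hl hf) (Primrec.const _))
  exact Primrec.and.comp
    (hne (Primrec.encode.comp ((Primrec.const []).pair ((Primrec.const []).pair hi))))
    (Primrec.or.comp (Primrec.eq.decide.comp hv (Primrec.const 0))
      (Primrec.or.comp
        (Primrec.not.comp (primrec_node.comp (Primrec.fst.comp .fst) hσ'))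
        (Primrec.and.comp (primrec_node.comp (Primrec.snd.comp .fst) hτ')
          (hne (Primrec.encode.comp (hσ'.pair (hτ'.pair hi')))))))

/-- The maximal family. The `⟨a, b⟩`-th member tells which of the trees with indices `a` and `b`
has the larger rank; in particular it tells which one has a path if at least one does. -/
def maxFamily (n : ℕ) : Set ℕ :=
  {m | (m = 0 ∧ ¬ Evades (node n.unpair.2) (node n.unpair.1) [] []) ∨
    (m = 1 ∧ ¬ Evades (node n.unpair.1) (node n.unpair.2) [] [])}

lemma maxFamily_nonempty (n : ℕ) : (maxFamily n).Nonempty := by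
  by_cases h : Evades (node n.unpair.2) (node n.unpair.1) [] []
  · exact ⟨1, Or.inr ⟨rfl, h.not_swap⟩⟩
  · exact ⟨0, Or.inl ⟨rfl, h⟩⟩

lemma maxFamily_finite (n : ℕ) : (maxFamily n).Finite := by
  refine (Set.toFinite {0, 1}).subset ?_
  rintro m (⟨rfl, -⟩ | ⟨rfl, -⟩) <;> simp

lemma hasPath_of_mem_maxFamily {a b m : ℕ} (hm : m ∈ maxFamily (Nat.pair a b))
    (h : HasPath a ∨ HasPath b) : (m = 0 ∧ HasPath a) ∨ (m = 1 ∧ HasPath b) := by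
  simp only [maxFamily, Nat.unpair_pair, Set.mem_ofPred_eq] at hm
  refine hm.imp (And.imp_right fun hE => ?_) (And.imp_right fun hE => ?_)
  · exact h.elim id fun ⟨_, hx⟩ => exists_path_of_not_evades hE (node_nil a) hx
  · exact h.elim (fun ⟨_, hx⟩ => exists_path_of_not_evades hE (node_nil b) hx) id

lemma uniformlySigma11_maxFamily : UniformlySigma11 maxFamily := by
  let q : ℕ × ℕ → ℕ × ℕ := fun p => if p.2 = 0 then p.1.unpair.swap else p.1.unpair
  have hq : Primrec q := by
    have hu : Primrec fun p : ℕ × ℕ => p.1.unpair := Primrec.unpair.comp .fst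
    exact Primrec.ite (Primrec.eq.comp .snd (.const 0))
      ((Primrec.snd.comp hu).pair (Primrec.fst.comp hu)) hu
  refine ⟨fun p l => decide (p.2 ≤ 1) && strategyCheck (node (q p).1) (node (q p).2) l,
    Primrec.to_comp (Primrec.and.comp
      (Primrec.nat_le.decide.comp (Primrec.snd.comp .fst) (.const 1))
      (primrec_strategyCheck.comp (hq.comp .fst) .snd)), fun n m => ?_⟩
  simp only [Bool.and_eq_true, decide_eq_true_eq, forall_const, forall_and, exists_and_left,
    ← not_evades_iff_exists_strategy, maxFamily, Set.mem_ofPred_eq]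
  rcases m with _ | _ | m <;> simp [q]

/-- `constraint (σ, j, b) l` says that `l` is compatible with being an initial segment of some `x`
that extends `σ` and satisfies `j < x |σ|` if `b` is true and `x |σ| = j` otherwise. -/
def constraint (c : List ℕ × ℕ × Bool) (l : List ℕ) : Bool :=
  decide (l.length ≤ c.1.length) || (decide (l.take c.1.length = c.1) &&
    bif c.2.2 then decide (c.2.1 < l.getD c.1.length 0) else decide (l.getD c.1.length 0 = c.2.1))

lemma primrec_constraint : Primrec₂ constraint := by
  have hl : Primrec fun z : (List ℕ × ℕ × Bool) × List ℕ => z.2 := .snd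
  have hσ : Primrec fun z : (List ℕ × ℕ × Bool) × List ℕ => z.1.1 := .comp .fst .fst
  have hj : Primrec fun z : (List ℕ × ℕ × Bool) × List ℕ => z.1.2.1 :=
    Primrec.fst.comp (.comp .snd .fst)
  have hb : Primrec fun z : (List ℕ × ℕ × Bool) × List ℕ => z.1.2.2 :=
    Primrec.snd.comp (.comp .snd .fst)
  have hn := Primrec.list_length.comp hσ
  have hv := (Primrec.list_getD 0).comp hl hn
  exact Primrec.or.comp (Primrec.nat_le.decide.comp (Primrec.list_length.comp hl) hn)
    (Primrec.and.comp (Primrec.eq.decide.comp (Primrec.list_take.comp hn hl) hσ)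
      (Primrec.cond hb (Primrec.nat_lt.decide.comp hj hv) (Primrec.eq.decide.comp hv hj)))

lemma forall_constraint_iff (σ : List ℕ) (j : ℕ) (b : Bool) (x : Baire) :
    (∀ k, constraint (σ, j, b) (pre x k) = true) ↔
      pre x σ.length = σ ∧ bif b then j < x σ.length else x σ.length = j := by
  constructor
  · intro h
    have := h (σ.length + 1)
    rw [constraint, pre_take x (by simp), pre_getD x (by simp)] at this
    cases b <;> simpa [pre_length] using this
  · intro h k
    rcases le_or_gt k σ.length with hk | hk
    · simp [constraint, pre_length, hk]
    · rw [constraint, pre_take x hk.le, pre_getD x hk]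
      cases b <;> simpa [pre_length, hk.not_ge] using h

lemma exists_index_constraint {S : Set Baire} (hS : Sigma11Set S) :
    ∃ e : ℕ, ∀ σ j b, HasPath (Nat.pair e (encode (σ, j, b))) ↔
      ∃ x ∈ S, pre x σ.length = σ ∧ bif b then j < x σ.length else x σ.length = j := by
  obtain ⟨R, hR, hS⟩ := hS
  let R' : List ℕ × ℕ × Bool → List ℕ → Bool := fun c l =>
    constraint c (l.map fun n => n.unpair.1) &&
      R (l.map fun n => n.unpair.1) (l.map fun n => n.unpair.2)
  have hR' : Computable₂ R' := by
    have h1 : Primrec fun z : (List ℕ × ℕ × Bool) × List ℕ => z.2.map fun n => n.unpair.1 :=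
      Primrec.list_map .snd (Primrec.fst.comp (Primrec.unpair.comp .snd))
    have h2 : Primrec fun z : (List ℕ × ℕ × Bool) × List ℕ => z.2.map fun n => n.unpair.2 :=
      Primrec.list_map .snd (Primrec.snd.comp (Primrec.unpair.comp .snd))
    exact Primrec.and.to_comp.comp (primrec_constraint.comp .fst h1).to_comp
      (hR.comp h1.to_comp h2.to_comp)
  obtain ⟨e, he⟩ := exists_index hR'
  refine ⟨e, fun σ j b => (he _).trans ?_⟩
  simp only [R', Bool.and_eq_true, forall_and, pre_map, forall_constraint_iff, hS]
  constructor
  · rintro ⟨y, h1, h2⟩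
    exact ⟨_, ⟨_, h2⟩, h1⟩
  · rintro ⟨x, ⟨w, h2⟩, h1⟩
    refine ⟨fun n => Nat.pair (x n) (w n), ?_⟩
    simpa using And.intro h1 h2

/-- A state `(σ, j)` of the search for an element of a `Σ¹₁` set stands for the constraint that
the element extends `σ` and has value at least `j` at `|σ|`. The position `query e s` of a member
of `homProd maxFamily` tells whether this value may be taken to be `j` or larger than `j`. -/
def query (e : ℕ) (s : List ℕ × ℕ) : ℕ :=
  Nat.pair (Nat.pair e (encode (s.1, s.2, false))) (Nat.pair e (encode (s.1, s.2, true)))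

/-- One step of the search, with answers taken from the finite sequence `τ`; the search waits if
the answer is not available. -/
def searchStep (e : ℕ) (τ : List ℕ) (s : List ℕ × ℕ) : List ℕ × ℕ :=
  if τ[query e s]? = none then s
  else if τ[query e s]? = some 0 then (s.1 ++ [s.2], 0) else (s.1, s.2 + 1)

/-- One step of the search, with answers taken from `x`. -/
def searchNext (e : ℕ) (x : Baire) (s : List ℕ × ℕ) : List ℕ × ℕ :=
  if x (query e s) = 0 then (s.1 ++ [s.2], 0) else (s.1, s.2 + 1)

lemma searchStep_pre {e m : ℕ} (x : Baire) {s : List ℕ × ℕ} (h : query e s < m) :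
    searchStep e (pre x m) s = searchNext e x s := by
  simp [searchStep, searchNext, pre_getElem? x h]

lemma prefix_searchStep (e : ℕ) (τ : List ℕ) (s : List ℕ × ℕ) : s.1 <+: (searchStep e τ s).1 := by
  unfold searchStep
  split_ifs <;> simp

lemma prefix_searchNext (e : ℕ) (x : Baire) (s : List ℕ × ℕ) : s.1 <+: (searchNext e x s).1 := by
  unfold searchNext
  split_ifs <;> simp

lemma prefix_iterate {f : List ℕ × ℕ → List ℕ × ℕ} (hf : ∀ s, s.1 <+: (f s).1)
    (s : List ℕ × ℕ) {m n : ℕ} (h : m ≤ n) : (f^[m] s).1 <+: (f^[n] s).1 := by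
  induction h with
  | refl => exact List.prefix_rfl
  | step _ ih =>
    rw [Function.iterate_succ_apply']
    exact ih.trans (hf _)

lemma exists_iterate_searchStep_eq (e : ℕ) {τ τ' : List ℕ} (h : τ <+: τ') (s : List ℕ × ℕ)
    (n : ℕ) : ∃ m ≤ n, (searchStep e τ)^[n] s = (searchStep e τ')^[m] s := by
  induction n with
  | zero => exact ⟨0, le_rfl, rfl⟩
  | succ n ih =>
    obtain ⟨m, hm, ih⟩ := ih
    rw [Function.iterate_succ_apply', ih]
    by_cases hq : τ[query e ((searchStep e τ')^[m] s)]? = none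
    · exact ⟨m, by omega, by rw [searchStep, if_pos hq]⟩
    · refine ⟨m + 1, by omega, ?_⟩
      rw [Function.iterate_succ_apply']
      have : τ'[query e ((searchStep e τ')^[m] s)]? = τ[query e ((searchStep e τ')^[m] s)]? := by
        obtain ⟨u, rfl⟩ := h
        exact List.getElem?_append_left (by simpa using hq)
      rw [searchStep, searchStep, this]

lemma primrec_searchStep (e : ℕ) : Primrec₂ (searchStep e) := by
  have h1 : Primrec fun z : List ℕ × List ℕ × ℕ => z.2.1 := .comp .fst .snd
  have h2 : Primrec fun z : List ℕ × List ℕ × ℕ => z.2.2 := .comp .snd .snd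
  have hc (b : Bool) : Primrec fun z : List ℕ × List ℕ × ℕ =>
      Nat.pair e (encode (z.2.1, z.2.2, b)) :=
    Primrec₂.natPair.comp (.const e) (Primrec.encode.comp (h1.pair (h2.pair (.const b))))
  have hq : Primrec fun z : List ℕ × List ℕ × ℕ => z.1[query e z.2]? :=
    Primrec.list_getElem?.comp .fst (Primrec₂.natPair.comp (hc false) (hc true))
  exact Primrec.ite (Primrec.eq.comp hq (.const none)) .snd
    (Primrec.ite (Primrec.eq.comp hq (.const (some 0)))
      ((Primrec.list_concat.comp h1 h2).pair (.const 0)) (h1.pair (Primrec.succ.comp h2)))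

/-- The Turing functional that outputs the sequence found by the search. -/
def searchFunctional (e : ℕ) : TuringFunctional where
  φ τ := ((searchStep e τ)^[τ.length] ([], 0)).1
  computable := (Primrec.fst.comp
    (Primrec.nat_iterate .list_length (.const _) (primrec_searchStep e))).to_comp
  mono τ τ' h := by
    obtain ⟨m, hm, hτ⟩ := exists_iterate_searchStep_eq e h ([], 0) τ.length
    rw [hτ]
    exact prefix_iterate (prefix_searchStep e τ') _ (hm.trans h.length_le)

lemma exists_prefix_searchFunctional (e : ℕ) (x : Baire) (k : ℕ) :
    ∃ m, ((searchNext e x)^[k] ([], 0)).1 <+: (searchFunctional e).φ (pre x m) := by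
  obtain ⟨b, hb⟩ : ∃ b, ∀ i < k, query e ((searchNext e x)^[i] ([], 0)) < b := by
    obtain ⟨b, hb⟩ := ((Set.finite_lt_nat k).image
      fun i => query e ((searchNext e x)^[i] ([], 0))).bddAbove
    exact ⟨b + 1, fun i hi => Nat.lt_succ_of_le (hb ⟨i, hi, rfl⟩)⟩
  have heq : ∀ i ≤ k, (searchStep e (pre x (max b k)))^[i] ([], 0) =
      (searchNext e x)^[i] ([], 0) := by
    intro i hi
    induction i with
    | zero => rfl
    | succ i ih =>
      rw [Function.iterate_succ_apply', Function.iterate_succ_apply', ih (by omega)]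
      exact searchStep_pre x (lt_max_of_lt_left (hb i hi))
  refine ⟨max b k, ?_⟩
  rw [← heq k le_rfl]
  refine prefix_iterate (prefix_searchStep e _) _ ?_
  rw [pre_length]
  exact le_max_right b k

lemma exists_eval_searchFunctional {e : ℕ} {x : Baire}
    (h : ∀ L, ∃ k, L < ((searchNext e x)^[k] ([], 0)).1.length) :
    ∃ y : Baire, (searchFunctional e).Eval x y ∧
      ∀ n, ∃ k, pre y n <+: ((searchNext e x)^[k] ([], 0)).1 := by
  set t : ℕ → List ℕ := fun k => ((searchNext e x)^[k] ([], 0)).1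
  have ht : ∀ {m n}, m ≤ n → t m <+: t n := prefix_iterate (prefix_searchNext e x) _
  choose K hK using h
  have key : ∀ k i, i < (t k).length → (t k)[i]? = some ((t (K i)).getD i 0) := by
    intro k i hi
    have hKi : i < (t (K i)).length := hK i
    rw [List.getD_eq_getElem _ _ hKi, List.getElem?_eq_getElem hi]
    rcases le_total k (K i) with hk | hk
    · rw [(ht hk).getElem hi]
    · rw [(ht hk).getElem hKi]
  refine ⟨fun n => (t (K n)).getD n 0, fun n => ?_, fun n => ⟨K n, ?_⟩⟩
  · obtain ⟨m, u, hm⟩ := exists_prefix_searchFunctional e x (K n)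
    refine ⟨m, ?_⟩
    rw [← hm, List.getElem?_append_left (hK n)]
    exact key _ _ (hK n)
  · rw [List.prefix_iff_eq_take, pre_length]
    refine List.ext_getElem? fun i => ?_
    rcases lt_or_ge i n with hi | hi
    · rw [pre_getElem? _ hi, List.getElem?_take_of_lt hi]
      exact (key _ _ (hi.trans (hK n))).symm
    · rw [pre_getElem?_of_le _ hi, List.getElem?_take_eq_none hi]

lemma mem_of_isClosed_of_forall_pre {S : Set Baire} (hS : IsClosed S) {y : Baire}
    (h : ∀ n, ∃ x ∈ S, pre x n = pre y n) : y ∈ S := by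
  choose x hx hxy using h
  refine hS.mem_of_tendsto (b := Filter.atTop) (f := x) ?_ (Filter.Eventually.of_forall hx)
  refine tendsto_pi_nhds.2 fun i => tendsto_const_nhds.congr' ?_
  filter_upwards [Filter.eventually_gt_atTop i] with n hn
  exact (pre_eq_pre_iff.1 (hxy n) i hn).symm

theorem medvedevLE_homProd_maxFamily {S : Set Baire} (hne : S.Nonempty) (hc : IsCompact S)
    (hS : Sigma11Set S) : MedvedevLE S (homProd maxFamily) := by
  obtain ⟨e, he⟩ := exists_index_constraint hS
  refine ⟨searchFunctional e, fun x hx => ?_⟩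
  let Alive : List ℕ × ℕ → Prop := fun s =>
    ∃ z ∈ S, pre z s.1.length = s.1 ∧ s.2 ≤ z s.1.length
  have hstep : ∀ s, Alive s → Alive (searchNext e x s) := by
    rintro ⟨σ, j⟩ ⟨z, hz, hσ, hj⟩
    have hp : HasPath (Nat.pair e (encode (σ, j, false))) ∨
        HasPath (Nat.pair e (encode (σ, j, true))) := by
      rw [he, he]
      exact hj.eq_or_lt.imp (fun h => ⟨z, hz, hσ, h.symm⟩) fun h => ⟨z, hz, hσ, h⟩
    have hq : x (query e (σ, j)) ∈ _ := hx (query e (σ, j))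
    rcases hasPath_of_mem_maxFamily hq hp with ⟨h0, h⟩ | ⟨h1, h⟩
    · obtain ⟨w, hw, hσw, hj⟩ := (he _ _ _).1 h
      rw [searchNext, if_pos h0]
      refine ⟨w, hw, ?_, Nat.zero_le _⟩
      rw [List.length_append, List.length_singleton, pre_succ, hσw]
      exact congrArg (fun v => σ ++ [v]) hj
    · obtain ⟨w, hw, hσw, hj⟩ := (he _ _ _).1 h
      rw [searchNext, if_neg (by omega)]
      exact ⟨w, hw, hσw, hj⟩
  have halive : ∀ k, Alive ((searchNext e x)^[k] ([], 0)) := by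
    intro k
    induction k with
    | zero =>
      obtain ⟨z, hz⟩ := hne
      exact ⟨z, hz, rfl, Nat.zero_le _⟩
    | succ k ih =>
      rw [Function.iterate_succ_apply']
      exact hstep _ ih
  have hgrow : ∀ k, ∃ k', ((searchNext e x)^[k] ([], 0)).1.length <
      ((searchNext e x)^[k'] ([], 0)).1.length := by
    intro k
    set s := (searchNext e x)^[k] ([], 0) with hs
    by_contra! hle
    have hstay : ∀ i, (searchNext e x)^[i + k] ([], 0) = (s.1, s.2 + i) := by
      intro i
      induction i with
      | zero => rw [Nat.zero_add]; exact hs.symm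
      | succ i ih =>
        have := hle (i + 1 + k)
        rw [Nat.add_right_comm, Function.iterate_succ_apply', ih, searchNext] at this ⊢
        split_ifs at this ⊢
        · simp at this
        · rfl
    obtain ⟨b, hb⟩ := (hc.image (continuous_apply s.1.length)).bddAbove
    obtain ⟨z, hz, -, hj⟩ := halive (b + 1 + k)
    rw [hstay] at hj
    have : z s.1.length ≤ b := hb ⟨z, hz, rfl⟩
    simp only at hj
    omega
  have hlen : ∀ L, ∃ k, L < ((searchNext e x)^[k] ([], 0)).1.length := by
    intro L
    induction L with
    | zero => exact (hgrow 0).imp fun _ h => Nat.zero_lt_of_lt h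
    | succ L ih =>
      obtain ⟨k, hk⟩ := ih
      exact (hgrow k).imp fun _ h => by omega
  obtain ⟨y, hy, hpre⟩ := exists_eval_searchFunctional hlen
  refine ⟨y, mem_of_isClosed_of_forall_pre hc.isClosed fun n => ?_, hy⟩
  obtain ⟨k, hk⟩ := hpre n
  obtain ⟨z, hz, hσ, -⟩ := halive k
  refine ⟨z, hz, ?_⟩
  rw [← hσ] at hk
  have := (prefix_pre_iff (by simpa [pre_length] using hk.length_le)).1 hk
  rwa [pre_length] at this

lemma sigma11Set_homProd {A : ℕ → Set ℕ} (hA : UniformlySigma11 A) : Sigma11Set (homProd A) := by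
  obtain ⟨R, hR, hA⟩ := hA
  let R' : List ℕ → List ℕ → Bool := fun xs ys =>
    let p := (xs.length - 1).unpair
    decide (xs.length = 0) ||
      R (p.1, xs.getD p.1 0) ((List.range p.2).map fun i => ys.getD (Nat.pair p.1 i) 0)
  have hp : Primrec fun z : List ℕ × List ℕ => (z.1.length - 1).unpair :=
    Primrec.unpair.comp (Primrec.pred.comp (Primrec.list_length.comp .fst))
  have hR' : Computable₂ R' := by
    refine Primrec.or.to_comp.comp
      (Primrec.eq.decide.comp (Primrec.list_length.comp .fst) (.const 0)).to_comp
      (hR.comp ((Primrec.fst.comp hp).pair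
        ((Primrec.list_getD 0).comp .fst (Primrec.fst.comp hp))).to_comp
      (Primrec.list_map (Primrec.list_range.comp (Primrec.snd.comp hp)) ?_).to_comp)
    exact (Primrec.list_getD 0).comp (Primrec.snd.comp .fst)
      (Primrec₂.natPair.comp (Primrec.fst.comp (hp.comp .fst)) .snd)
  have hspec : ∀ x y : Baire, (∀ m, R' (pre x m) (pre y m) = true) ↔
      ∀ n k, R (n, x n) (pre (fun i => y (Nat.pair n i)) k) = true := by
    intro x y
    have hsucc : ∀ n k, R' (pre x (Nat.pair n k + 1)) (pre y (Nat.pair n k + 1)) =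
        R (n, x n) (pre (fun i => y (Nat.pair n i)) k) := by
      intro n k
      have hl : (List.range k).map (fun i => (pre y (Nat.pair n k + 1)).getD (Nat.pair n i) 0) =
          pre (fun i => y (Nat.pair n i)) k := by
        refine List.map_congr_left fun i hi => pre_getD y ?_
        exact (Nat.pair_lt_pair_right n (List.mem_range.1 hi)).trans (Nat.lt_succ_self _)
      simp only [R', pre_length, Nat.add_sub_cancel, Nat.unpair_pair, hl,
        pre_getD x (Nat.lt_succ_of_le (Nat.left_le_pair n k)), Nat.succ_ne_zero, decide_false,
        Bool.false_or]
    constructor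
    · intro h n k
      rw [← hsucc]
      exact h _
    · intro h m
      cases m with
      | zero => simp only [R', pre_length, decide_true, Bool.true_or]
      | succ m =>
        rw [← Nat.pair_unpair m, hsucc]
        exact h _ _
  refine ⟨R', hR', fun x => ?_⟩
  simp only [hspec, homProd, Set.mem_ofPred_eq, hA]
  constructor
  · intro h
    choose w hw using h
    exact ⟨fun n => w n.unpair.1 n.unpair.2, fun n => by simpa using hw n⟩
  · rintro ⟨y, hy⟩ n
    exact ⟨_, hy n⟩

lemma homProd_eq_pi (A : ℕ → Set ℕ) : homProd A = Set.univ.pi A := by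
  ext x
  simp [homProd]

/-- There is a uniformly `Σ¹₁` family `(Mₙ)` of nonempty finite subsets of `ℕ`
such that every nonempty compact `Σ¹₁` subset of Baire space is Medvedev
reducible to `∏ₙ Mₙ`; in particular every nonempty homogeneous `Σ¹₁` set with
all factors finite is Medvedev reducible to `∏ₙ Mₙ`, so the corresponding
Medvedev degrees have a maximum. -/
theorem exists_maximum_compact_sigma11 :
    ∃ M : ℕ → Set ℕ, UniformlySigma11 M ∧ (∀ n, (M n).Nonempty ∧ (M n).Finite) ∧
      (∀ S : Set Baire, S.Nonempty → IsCompact S → Sigma11Set S →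
        MedvedevLE S (homProd M)) ∧
      (∀ A : ℕ → Set ℕ, UniformlySigma11 A → (∀ n, (A n).Nonempty ∧ (A n).Finite) →
        MedvedevLE (homProd A) (homProd M)) := by
  refine ⟨maxFamily, uniformlySigma11_maxFamily,
    fun n => ⟨maxFamily_nonempty n, maxFamily_finite n⟩,
    fun S hne hc hS => medvedevLE_homProd_maxFamily hne hc hS, fun A hA hfin => ?_⟩
  refine medvedevLE_homProd_maxFamily ?_ ?_ (sigma11Set_homProd hA)
  · rw [homProd_eq_pi]
    exact Set.univ_pi_nonempty_iff.2 fun n => (hfin n).1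
  · rw [homProd_eq_pi]
    exact isCompact_univ_pi fun n => (hfin n).2.isCompact
end
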